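/- arXiv:1207.0638 — 2 statements merged into one kernel-verified Lean document; each statement's English description precedes it below -/
import Mathlib

section
/- Let X be a finite abstract simplicial complex of dimension d on n vertices with a complete skeleton, and let X̄ be the complement complex: X̄^j = X^j for j ≤ d−1 and X̄^d consists of all (d+1)-subsets of V not in X^d. Then the upper Laplacian of X̄ satisfies Δ+_{X̄} = n·I − Δ_X as operators on Ω^{d-1}, where Δ_X = Δ+_X + Δ−_X is the full Laplacian of X. -/
open Finset

/-- A finite abstract simplicial complex on the vertex type `V`: a collection of finite
subsets of `V` (the cells), closed under taking subsets and containing the empty cell. -/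
structure SComplex (V : Type) [Fintype V] [DecidableEq V] : Type where
  cells : Finset (Finset V)
  empty_mem : ∅ ∈ cells
  down_closed : ∀ s ∈ cells, ∀ t ⊆ s, t ∈ cells

namespace SComplex

variable {V : Type} [Fintype V] [DecidableEq V]

/-- The cells of `X` with exactly `m` vertices, i.e. the `(m-1)`-dimensional cells `X^{m-1}`. -/
def cellsCard (X : SComplex V) (m : ℕ) : Finset (Finset V) :=
  X.cells.filter fun s => s.card = m

/-- `X` is `D`-dimensional: every cell has at most `D+1` vertices and some cell has
exactly `D+1` vertices. -/
def Dim (X : SComplex V) (D : ℕ) : Prop :=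
  (∀ s ∈ X.cells, s.card ≤ D + 1) ∧ ∃ s ∈ X.cells, s.card = D + 1

/-- `X` (of dimension `D`) has a complete skeleton: every subset of `V` with at most `D`
elements is a cell. -/
def CompleteSkeleton (X : SComplex V) (D : ℕ) : Prop :=
  ∀ s : Finset V, s.card ≤ D → s ∈ X.cells

/-- The set of vertices of an ordered tuple. -/
def tset {m : ℕ} (σ : Fin m → V) : Finset V := Finset.image σ Finset.univ

/-- An ordered tuple of vertices is an oriented cell when it is injective and its vertex
set is a cell of `X`. -/
def IsCell (X : SComplex V) {m : ℕ} (σ : Fin m → V) : Prop :=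
  Function.Injective σ ∧ tset σ ∈ X.cells

instance (X : SComplex V) {m : ℕ} (σ : Fin m → V) : Decidable (X.IsCell σ) := by
  unfold IsCell; infer_instance

/-- `X.nbr v σ` : the vertex `v` does not belong to `σ` and together with `σ` spans a
cell of `X`. -/
def nbr (X : SComplex V) {m : ℕ} (v : V) (σ : Fin m → V) : Prop :=
  v ∉ tset σ ∧ insert v (tset σ) ∈ X.cells

instance (X : SComplex V) {m : ℕ} (v : V) (σ : Fin m → V) : Decidable (X.nbr v σ) := by
  unfold nbr; infer_instance

/-- `f` is an `(m-1)`-form on `X`: a function on ordered tuples of `m` vertices which is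
skew-symmetric with respect to permutations of the tuple, and is supported on the
oriented `(m-1)`-cells of `X`. -/
def IsForm (X : SComplex V) (m : ℕ) (f : (Fin m → V) → ℝ) : Prop :=
  (∀ (σ : Fin m → V) (π : Equiv.Perm (Fin m)),
      f (σ ∘ π) = ((Equiv.Perm.sign π : ℤ) : ℝ) * f σ) ∧
  ∀ σ : Fin m → V, ¬ X.IsCell σ → f σ = 0

/-- The space `Ω^{m-1}(X)` of `(m-1)`-forms, as a submodule of the functions on tuples. -/
def formSub (X : SComplex V) (m : ℕ) : Submodule ℝ ((Fin m → V) → ℝ) where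
  carrier := {f | X.IsForm m f}
  add_mem' := @fun f g hf hg => ⟨fun σ π => by
      simp only [Pi.add_apply, hf.1 σ π, hg.1 σ π]; ring,
    fun σ h => by simp only [Pi.add_apply, hf.2 σ h, hg.2 σ h, add_zero]⟩
  zero_mem' := ⟨fun σ π => by simp, fun σ h => rfl⟩
  smul_mem' := @fun c f hf => ⟨fun σ π => by
      simp only [Pi.smul_apply, smul_eq_mul, hf.1 σ π]; ring,
    fun σ h => by simp only [Pi.smul_apply, hf.2 σ h, smul_eq_mul, mul_zero]⟩

/-- The inner product `⟨f,g⟩ = ∑_{σ ∈ X^{m-1}} f(σ) g(σ)` on `(m-1)`-forms, computed via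
ordered tuples (each cell is counted `m!` times, once for each ordering of its vertices). -/
noncomputable def innerForm (m : ℕ) (f g : (Fin m → V) → ℝ) : ℝ :=
  ((m.factorial : ℝ))⁻¹ * ∑ σ : Fin m → V, f σ * g σ

/-- The boundary operator `∂ : Ω^m → Ω^{m-1}`, `(∂f)(σ) = ∑_{v ∼ σ} f(vσ)`. -/
def bdry (X : SComplex V) (m : ℕ) (f : (Fin (m+1) → V) → ℝ) : (Fin m → V) → ℝ :=
  fun σ => ∑ v : V, if X.nbr v σ then f (Fin.cons v σ) else 0

/-- The coboundary operator `∂* : Ω^{m-1} → Ω^m`, `(∂*f)(σ) = ∑ i (-1)^i f(σ ∖ σᵢ)`,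
supported on the oriented `m`-cells of `X`. -/
def cobdry (X : SComplex V) (m : ℕ) (f : (Fin m → V) → ℝ) : (Fin (m+1) → V) → ℝ :=
  fun σ => if X.IsCell σ then ∑ i : Fin (m+1), (-1 : ℝ) ^ (i : ℕ) * f (σ ∘ i.succAbove) else 0

/-- The upper Laplacian `Δ⁺ = ∂ ∘ ∂*` on `(m-1)`-forms. -/
def upLap (X : SComplex V) (m : ℕ) (f : (Fin m → V) → ℝ) : (Fin m → V) → ℝ :=
  X.bdry m (X.cobdry m f)

/-- The lower Laplacian `Δ⁻ = ∂* ∘ ∂` on `m`-forms. -/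
def lowLap (X : SComplex V) (m : ℕ) (f : (Fin (m+1) → V) → ℝ) : (Fin (m+1) → V) → ℝ :=
  X.cobdry m (X.bdry m f)

/-- The boundary operator as a linear map. -/
def bdryL (X : SComplex V) (m : ℕ) : ((Fin (m+1) → V) → ℝ) →ₗ[ℝ] ((Fin m → V) → ℝ) where
  toFun := X.bdry m
  map_add' f g := by
    funext σ
    show (∑ v : V, if X.nbr v σ then (f + g) (Fin.cons v σ) else 0) =
      (∑ v : V, if X.nbr v σ then f (Fin.cons v σ) else 0) +
      (∑ v : V, if X.nbr v σ then g (Fin.cons v σ) else 0)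
    rw [← Finset.sum_add_distrib]
    exact Finset.sum_congr rfl fun v _ => by by_cases h : X.nbr v σ <;> simp [h]
  map_smul' c f := by
    funext σ
    show (∑ v : V, if X.nbr v σ then (c • f) (Fin.cons v σ) else 0) =
      c * (∑ v : V, if X.nbr v σ then f (Fin.cons v σ) else 0)
    rw [Finset.mul_sum]
    exact Finset.sum_congr rfl fun v _ => by by_cases h : X.nbr v σ <;> simp [h]

/-- The coboundary operator as a linear map. -/
def cobdryL (X : SComplex V) (m : ℕ) : ((Fin m → V) → ℝ) →ₗ[ℝ] ((Fin (m+1) → V) → ℝ) where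
  toFun := X.cobdry m
  map_add' f g := by
    funext σ
    show X.cobdry m (f + g) σ = X.cobdry m f σ + X.cobdry m g σ
    unfold cobdry
    by_cases h : X.IsCell σ
    · simp only [h, if_true, ← Finset.sum_add_distrib]
      exact Finset.sum_congr rfl fun i _ => by simp [Pi.add_apply]; ring
    · simp [h]
  map_smul' c f := by
    funext σ
    show X.cobdry m (c • f) σ = c * X.cobdry m f σ
    unfold cobdry
    by_cases h : X.IsCell σ
    · simp only [h, if_true, Finset.mul_sum]
      exact Finset.sum_congr rfl fun i _ => by simp [Pi.smul_apply]; ring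
    · simp [h]

/-- The degree of a cell `s`: the number of cells with one more vertex containing `s`. -/
def degCell (X : SComplex V) (s : Finset V) : ℕ :=
  (X.cells.filter fun t => s ⊆ t ∧ t.card = s.card + 1).card

/-- The maximal degree of an `(m-1)`-cell of `X`. -/
def maxDeg (X : SComplex V) (m : ℕ) : ℕ :=
  (X.cellsCard m).sup fun s => X.degCell s

/-- The spectrum of the upper Laplacian of a `(d+1)`-dimensional complex restricted to
the cycle space `Z = ker ∂` inside the space of forms on `d+1` vertices. -/
def specUpLapZ (X : SComplex V) (d : ℕ) : Set ℝ :=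
  {μ | ∃ f : (Fin (d+1) → V) → ℝ,
    X.IsForm (d+1) f ∧ X.bdry d f = 0 ∧ f ≠ 0 ∧ X.upLap (d+1) f = μ • f}

/-- The spectral gap `λ(X) = min Spec (Δ⁺|_Z)` of a `(d+1)`-dimensional complex. -/
noncomputable def spectralGap (X : SComplex V) (d : ℕ) : ℝ :=
  sInf (X.specUpLapZ d)

/-- `F(A 0, …, A (m-1))`: the set of cells with `m` vertices having exactly one vertex
in each `A i`. -/
def Fcells (X : SComplex V) {m : ℕ} (A : Fin m → Finset V) : Finset (Finset V) :=
  X.cells.filter fun s => s.card = m ∧ ∀ i, (s ∩ A i).card = 1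

/-- The Cheeger constant of a `(d+1)`-dimensional complex: the minimum over all
partitions of the vertex set into `d+2` nonempty parts of `n·|F(A₀,…)|/∏|Aᵢ|`. -/
noncomputable def cheeger (X : SComplex V) (d : ℕ) : ℝ :=
  sInf { r : ℝ | ∃ A : Fin (d+2) → Finset V,
    (∀ i, (A i).Nonempty) ∧ (∀ i j, i ≠ j → Disjoint (A i) (A j)) ∧
    Finset.univ.biUnion A = Finset.univ ∧
    r = (Fintype.card V : ℝ) * ((X.Fcells A).card : ℝ) / ∏ i, ((A i).card : ℝ) }

/-- The `m`-th reduced Betti number `β_m = dim H_m` of `X` over `ℝ`: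
`dim (Ω^m ∩ ker ∂_m) - dim (∂_{m+1} Ω^{m+1})`. -/
noncomputable def betti (X : SComplex V) (m : ℕ) : ℕ :=
  Module.finrank ℝ ↥(X.formSub (m+1) ⊓ LinearMap.ker (X.bdryL m)) -
  Module.finrank ℝ ↥(Submodule.map (X.bdryL (m+1)) (X.formSub (m+2)))

/-- The vertices of the link of `τ`. -/
def linkVerts (X : SComplex V) (τ : Finset V) : Finset V :=
  Finset.univ.filter fun v => v ∉ τ ∧ insert v τ ∈ X.cells

/-- The neighbours of `v` in the link graph of `τ`. -/
def linkNbrs (X : SComplex V) (τ : Finset V) (v : V) : Finset V :=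
  Finset.univ.filter fun w => w ≠ v ∧ w ∉ τ ∧ v ∉ τ ∧ insert v (insert w τ) ∈ X.cells

/-- The graph Laplacian of the link of `τ`. -/
def linkLap (X : SComplex V) (τ : Finset V) (g : V → ℝ) : V → ℝ :=
  fun v => ((X.linkNbrs τ v).card : ℝ) * g v - ∑ w ∈ X.linkNbrs τ v, g w

/-- The graph spectral gap of the link of `τ`: the minimal eigenvalue of its graph
Laplacian on functions on its vertices summing to zero. -/
noncomputable def linkGap (X : SComplex V) (τ : Finset V) : ℝ :=
  sInf {μ : ℝ | ∃ g : V → ℝ, (∀ v, v ∉ X.linkVerts τ → g v = 0) ∧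
    (∑ v ∈ X.linkVerts τ, g v = 0) ∧ g ≠ 0 ∧
    ∀ v ∈ X.linkVerts τ, X.linkLap τ g v = μ * g v}

/-- The graph Cheeger constant of the link of `τ`: the minimum over partitions
`B ⊔ C` of its vertex set of `|W|·|E(B,C)|/(|B|·|C|)`. -/
noncomputable def linkCheeger (X : SComplex V) (τ : Finset V) : ℝ :=
  sInf { r : ℝ | ∃ B C : Finset V, B.Nonempty ∧ C.Nonempty ∧ Disjoint B C ∧
    B ∪ C = X.linkVerts τ ∧
    r = ((X.linkVerts τ).card : ℝ) *
        (((B ×ˢ C).filter fun p => insert p.1 (insert p.2 τ) ∈ X.cells).card : ℝ) /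
        ((B.card : ℝ) * (C.card : ℝ)) }

/-- `deg_τ(s)`: the number of neighbours `s'` of the cell `s` which contain `τ` (two
distinct cells with the same number of vertices are neighbours when their union is a
cell of `X` with one more vertex). -/
def degTau (X : SComplex V) (τ s : Finset V) : ℕ :=
  (X.cells.filter fun s' => s'.card = s.card ∧ s' ≠ s ∧ τ ⊆ s' ∧
    (s ∪ s').card = s.card + 1 ∧ s ∪ s' ∈ X.cells).card

/-- The local upper Laplacian `Δ⁺_τ` associated to a cell `τ` with `d` vertices of a
`(d+1)`-dimensional complex, acting on forms on `d+1` vertices: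
`(Δ⁺_τ f)(σ) = deg_τ(σ) f(σ) - ∑_{σ' ∼ σ, τ ⊆ σ'} f(σ')` when `τ ⊆ σ`, and `0` else. -/
def localUpLap (X : SComplex V) (d : ℕ) (τ : Finset V) (f : (Fin (d+1) → V) → ℝ) :
    (Fin (d+1) → V) → ℝ :=
  fun σ => if τ ⊆ tset σ then
      (X.degTau τ (tset σ) : ℝ) * f σ -
        ∑ v : V, if X.nbr v σ then
          ∑ i : Fin (d+1), if σ i ∉ τ then
            (-1 : ℝ) ^ (i : ℕ) * f (Fin.cons v σ ∘ Fin.succAbove i.succ) else 0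
        else 0
    else 0

/-- The complement complex `X̄` of a `D`-dimensional complex `X` with complete skeleton:
it has the same cells of dimension `< D`, and its `D`-dimensional cells are exactly the
vertex sets of size `D+1` which are not cells of `X`. -/
def complComplex (X : SComplex V) (D : ℕ) (hX : X.CompleteSkeleton D) : SComplex V where
  cells := (X.cells.filter fun s => s.card ≤ D) ∪
    ((Finset.univ : Finset V).powersetCard (D+1)).filter fun s => s ∉ X.cells
  empty_mem := Finset.mem_union_left _ (Finset.mem_filter.mpr ⟨X.empty_mem, by simp⟩)
  down_closed := by
    intro s hs t ht
    rcases Finset.mem_union.mp hs with h | h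
    · rw [Finset.mem_filter] at h
      exact Finset.mem_union_left _ (Finset.mem_filter.mpr
        ⟨X.down_closed s h.1 t ht, le_trans (Finset.card_le_card ht) h.2⟩)
    · rw [Finset.mem_filter, Finset.mem_powersetCard] at h
      by_cases hts : t = s
      · subst hts
        exact Finset.mem_union_right _ (Finset.mem_filter.mpr
          ⟨Finset.mem_powersetCard.mpr h.1, h.2⟩)
      · have hlt : t.card < s.card := Finset.card_lt_card (ht.ssubset_of_ne hts)
        have hsD : s.card = D + 1 := h.1.2
        have htD : t.card ≤ D := by omega
        exact Finset.mem_union_left _ (Finset.mem_filter.mpr ⟨hX t htD, htD⟩)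

/-- The simplicial complex on `V` with complete `(d+1)`-dimensional skeleton whose
top-dimensional cells (with `d+2` vertices) are the members of `T`: the Linial–Meshulam
complex determined by the sample `T`. -/
def lmComplex (V : Type) [Fintype V] [DecidableEq V] (d : ℕ) (T : Finset (Finset V)) :
    SComplex V where
  cells := (Finset.univ.powerset.filter fun s : Finset V => s.card ≤ d + 1) ∪
    T.filter fun s => s.card = d + 2
  empty_mem := Finset.mem_union_left _ (by simp)
  down_closed := by
    intro s hs t ht
    rcases Finset.mem_union.mp hs with h | h
    · rw [Finset.mem_filter] at h
      exact Finset.mem_union_left _ (Finset.mem_filter.mpr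
        ⟨Finset.mem_powerset.mpr (Finset.subset_univ t), le_trans (Finset.card_le_card ht) h.2⟩)
    · rw [Finset.mem_filter] at h
      by_cases hts : t = s
      · subst hts; exact Finset.mem_union_right _ (Finset.mem_filter.mpr h)
      · have hlt : t.card < s.card := Finset.card_lt_card (ht.ssubset_of_ne hts)
        have hsd : s.card = d + 2 := h.2
        have htd : t.card ≤ d + 1 := by omega
        exact Finset.mem_union_left _ (Finset.mem_filter.mpr
          ⟨Finset.mem_powerset.mpr (Finset.subset_univ t), htd⟩)

open Classical in
/-- The probability, under the Linial–Meshulam measure `X(d+1, n, p)` (each possible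
top-dimensional cell on `d+2` vertices is included independently with probability `p`),
of an event `E` depending on the set of top-dimensional cells. -/
noncomputable def lmProb (V : Type) [Fintype V] [DecidableEq V] (d : ℕ) (p : ℝ)
    (E : Finset (Finset V) → Prop) : ℝ :=
  ∑ T ∈ ((Finset.univ : Finset V).powersetCard (d+2)).powerset,
    if E T then
      p ^ T.card * (1 - p) ^ (((Finset.univ : Finset V).powersetCard (d+2)).card - T.card)
    else 0

end SComplex

namespace SComplex

variable {V : Type} [DecidableEq V]

theorem mem_tset {m : ℕ} {σ : Fin m → V} {v : V} : v ∈ tset σ ↔ ∃ i, σ i = v := by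
  simp [tset]

theorem tset_cons {m : ℕ} (v : V) (σ : Fin m → V) :
    tset (Fin.cons v σ : Fin (m + 1) → V) = insert v (tset σ) := by
  ext w
  simp [mem_tset, Fin.exists_fin_succ, eq_comm]

theorem card_tset_le {m : ℕ} (σ : Fin m → V) : (tset σ).card ≤ m :=
  Finset.card_image_le.trans (by simp)

theorem card_tset_of_injective {m : ℕ} {σ : Fin m → V} (hσ : Function.Injective σ) :
    (tset σ).card = m := by
  simp [tset, Finset.card_image_of_injective _ hσ]

variable [Fintype V]

theorem isCell_cons_iff {X : SComplex V} {m : ℕ} {v : V} {σ : Fin m → V} :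
    X.IsCell (Fin.cons v σ : Fin (m + 1) → V) ↔ Function.Injective σ ∧ X.nbr v σ := by
  simp only [IsCell, nbr, tset_cons, Fin.cons_injective_iff, mem_tset, Set.mem_range]
  tauto

theorem IsForm.eq_zero_of_not_injective {X : SComplex V} {m : ℕ} {f : (Fin m → V) → ℝ}
    (hf : X.IsForm m f) {σ : Fin m → V} (hσ : ¬ Function.Injective σ) : f σ = 0 :=
  hf.2 σ fun h => hσ h.1

/-- Moving the `j`-th entry of a tuple to the front multiplies a form by `(-1) ^ j`. -/
theorem IsForm.apply_cons_succAbove {X : SComplex V} {m : ℕ} {f : (Fin (m + 1) → V) → ℝ}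
    (hf : X.IsForm (m + 1) f) (σ : Fin (m + 1) → V) (j : Fin (m + 1)) :
    f (Fin.cons (σ j) (σ ∘ j.succAbove)) = (-1 : ℝ) ^ (j : ℕ) * f σ := by
  have h : (Fin.cons (σ j) (σ ∘ j.succAbove) : Fin (m + 1) → V) = σ ∘ j.cycleRange.symm := by
    funext i
    refine Fin.cases ?_ (fun i => ?_) i <;> simp
  rw [h, hf.1, Equiv.Perm.sign_symm, Fin.sign_cycleRange]
  simp

/-- With a complete skeleton, the boundary of a form on `m + 1` vertices is the sum over all
vertices. -/
theorem IsForm.bdry_apply {X : SComplex V} {m : ℕ} {f : (Fin (m + 1) → V) → ℝ}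
    (hf : X.IsForm (m + 1) f) (hX : X.CompleteSkeleton (m + 1)) (τ : Fin m → V) :
    X.bdry m f τ = ∑ v : V, f (Fin.cons v τ) := by
  refine Finset.sum_congr rfl fun v _ => ?_
  split_ifs with h
  · rfl
  · refine (hf.eq_zero_of_not_injective fun hinj => h ?_).symm
    rw [Fin.cons_injective_iff] at hinj
    refine ⟨fun hv => hinj.1 (mem_tset.mp hv), hX _ ?_⟩
    exact (Finset.card_insert_le _ _).trans (Nat.succ_le_succ (card_tset_le τ))

/-- The unrestricted coboundary of `f` on the tuple `Fin.cons v σ`. -/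
def consCobdry {m : ℕ} (f : (Fin (m + 1) → V) → ℝ) (σ : Fin (m + 1) → V) (v : V) : ℝ :=
  f σ - ∑ i : Fin (m + 1), (-1 : ℝ) ^ (i : ℕ) * f (Fin.cons v (σ ∘ i.succAbove))

theorem upLap_apply (X : SComplex V) {m : ℕ} (f : (Fin (m + 1) → V) → ℝ)
    {σ : Fin (m + 1) → V} (hσ : Function.Injective σ) :
    X.upLap (m + 1) f σ = ∑ v : V, if X.nbr v σ then consCobdry f σ v else 0 := by
  refine Finset.sum_congr rfl fun v _ => if_ctx_congr Iff.rfl (fun h => ?_) fun _ => rfl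
  have hcons (i : Fin (m + 1)) :
      (Fin.cons v σ : Fin (m + 2) → V) ∘ i.succ.succAbove = Fin.cons v (σ ∘ i.succAbove) := by
    funext k
    refine Fin.cases ?_ (fun k => ?_) k <;> simp
  have hzero : (Fin.cons v σ : Fin (m + 2) → V) ∘ Fin.succAbove 0 = σ := by
    funext k
    simp
  rw [cobdry, if_pos (isCell_cons_iff.mpr ⟨hσ, h⟩), Fin.sum_univ_succ]
  simp only [hcons, hzero, consCobdry, Fin.val_zero, Fin.val_succ, pow_zero, pow_succ]
  simp [sub_eq_add_neg]

theorem upLap_apply_of_not_injective (X : SComplex V) {m : ℕ} (f : (Fin m → V) → ℝ)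
    {σ : Fin m → V} (hσ : ¬ Function.Injective σ) : X.upLap m f σ = 0 :=
  Finset.sum_eq_zero fun v _ => by
    rw [cobdry, if_neg fun h => hσ (isCell_cons_iff.mp h).1, ite_self]

theorem IsForm.consCobdry_of_mem {X : SComplex V} {m : ℕ} {f : (Fin (m + 1) → V) → ℝ}
    (hf : X.IsForm (m + 1) f) {σ : Fin (m + 1) → V} {v : V} (hv : v ∈ tset σ) :
    consCobdry f σ v = 0 := by
  obtain ⟨j, rfl⟩ := mem_tset.mp hv
  rw [consCobdry, Finset.sum_eq_single j, hf.apply_cons_succAbove, ← mul_assoc, ← mul_pow]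
  · simp
  · intro i _ hij
    rw [hf.eq_zero_of_not_injective, mul_zero]
    rw [Fin.cons_injective_iff]
    obtain ⟨k, hk⟩ := Fin.exists_succAbove_eq hij.symm
    exact fun h => h.1 ⟨k, by simp [hk]⟩
  · simp

theorem nbr_complComplex_iff (X : SComplex V) {m : ℕ} (hX : X.CompleteSkeleton m)
    {σ : Fin m → V} (hσ : Function.Injective σ) (v : V) :
    (X.complComplex m hX).nbr v σ ↔ v ∉ tset σ ∧ ¬ X.nbr v σ := by
  refine and_congr_right fun hv => ?_
  have hcard : (insert v (tset σ)).card = m + 1 := by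
    rw [Finset.card_insert_of_notMem hv, card_tset_of_injective hσ]
  simp [complComplex, nbr, hv, hcard]

theorem IsForm.lowLap_apply {X : SComplex V} {m : ℕ} {f : (Fin (m + 1) → V) → ℝ}
    (hf : X.IsForm (m + 1) f) (hX : X.CompleteSkeleton (m + 1)) {σ : Fin (m + 1) → V}
    (hσ : Function.Injective σ) :
    X.lowLap m f σ = ∑ v : V, (f σ - consCobdry f σ v) := by
  rw [lowLap, cobdry, if_pos ⟨hσ, hX _ (card_tset_le σ)⟩]
  simp only [hf.bdry_apply hX, consCobdry, sub_sub_cancel, Finset.mul_sum]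
  exact Finset.sum_comm

end SComplex

open SComplex in
/-- Proposition 3.2(1): for a `(d+1)`-dimensional complex `X` with a complete skeleton
on `n` vertices, the upper Laplacian of the complement complex satisfies
`Δ⁺_{X̄} = n·I − Δ_X` on `Ω^{d}`, where `Δ_X = Δ⁺_X + Δ⁻_X` is the full Laplacian. -/
theorem complement_upLap (V : Type) [Fintype V] [DecidableEq V] (d : ℕ)
    (X : SComplex V) (hdim : X.Dim (d + 1)) (hskel : X.CompleteSkeleton (d + 1))
    (f : (Fin (d + 1) → V) → ℝ) (hf : X.IsForm (d + 1) f) :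
    (X.complComplex (d + 1) hskel).upLap (d + 1) f =
      (Fintype.card V : ℝ) • f - (X.upLap (d + 1) f + X.lowLap d f) := by
  funext σ
  simp only [Pi.sub_apply, Pi.add_apply, Pi.smul_apply, smul_eq_mul]
  by_cases hσ : Function.Injective σ
  · have hsum : (X.complComplex (d + 1) hskel).upLap (d + 1) f σ + X.upLap (d + 1) f σ =
        ∑ v : V, consCobdry f σ v := by
      rw [upLap_apply _ f hσ, upLap_apply _ f hσ, ← Finset.sum_add_distrib]
      refine Finset.sum_congr rfl fun v _ => ?_
      simp only [nbr_complComplex_iff X hskel hσ]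
      by_cases hv : v ∈ tset σ
      · simp [hf.consCobdry_of_mem hv]
      · by_cases h : X.nbr v σ <;> simp [hv, h]
    have hlow := hf.lowLap_apply hskel hσ
    rw [Finset.sum_sub_distrib, Finset.sum_const, Finset.card_univ, nsmul_eq_mul] at hlow
    linarith
  · have hlow : X.lowLap d f σ = 0 := if_neg fun h => hσ h.1
    simp [upLap_apply_of_not_injective _ f hσ, hlow, hf.eq_zero_of_not_injective hσ]
end

section
/- Let X be a finite abstract simplicial complex of dimension d on n vertices with a complete skeleton. Then the spectrum of the full Laplacian Δ = Δ+ + Δ− on Ω^{d-1} is contained in the interval [0, n]. -/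
open Finset

namespace SComplex

variable {V : Type}

/-- Skew-symmetry of a function of ordered tuples under permutations of the tuple. -/
def IsSkew {m : ℕ} (f : (Fin m → V) → ℝ) : Prop :=
  ∀ (σ : Fin m → V) (π : Equiv.Perm (Fin m)),
    f (σ ∘ π) = ((Equiv.Perm.sign π : ℤ) : ℝ) * f σ

/-- The coboundary on all tuples, i.e. for the full simplex on `V`. -/
def altSum {m : ℕ} (f : (Fin m → V) → ℝ) (τ : Fin (m + 1) → V) : ℝ :=
  ∑ i : Fin (m + 1), (-1 : ℝ) ^ (i : ℕ) * f (τ ∘ i.succAbove)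

/-- The boundary on all tuples, i.e. for the full simplex on `V`. -/
def consSum [Fintype V] {m : ℕ} (f : (Fin (m + 1) → V) → ℝ) (σ : Fin m → V) : ℝ :=
  ∑ v : V, f (Fin.cons v σ)

theorem sign_mul_self_cast {m : ℕ} (π : Equiv.Perm (Fin m)) :
    ((Equiv.Perm.sign π : ℤ) : ℝ) * ((Equiv.Perm.sign π : ℤ) : ℝ) = 1 := by
  rcases Int.units_eq_one_or (Equiv.Perm.sign π) with h | h <;> simp [h]

theorem sign_cycleRange_cast {m : ℕ} (i : Fin (m + 1)) :
    ((Equiv.Perm.sign i.cycleRange : ℤ) : ℝ) = (-1) ^ (i : ℕ) := by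
  simp [Fin.sign_cycleRange]

theorem comp_cycleRange_symm_succ {m : ℕ} (τ : Fin (m + 1) → V) (i : Fin (m + 1)) :
    (τ ∘ i.cycleRange.symm) ∘ Fin.succ = τ ∘ i.succAbove := by
  funext j
  simp [Fin.cycleRange_symm_succ]

theorem altSum_eq_sum_sign {m : ℕ} (f : (Fin m → V) → ℝ) (τ : Fin (m + 1) → V) :
    altSum f τ = ∑ i : Fin (m + 1), ((Equiv.Perm.sign i.cycleRange : ℤ) : ℝ) *
      f ((τ ∘ i.cycleRange.symm) ∘ Fin.succ) := by
  simp only [altSum, sign_cycleRange_cast, comp_cycleRange_symm_succ]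

theorem IsSkew.comp_succ_of_fix_zero {m : ℕ} {f : (Fin m → V) → ℝ} (hf : IsSkew f)
    (τ : Fin (m + 1) → V) (ρ : Equiv.Perm (Fin (m + 1))) (hρ : ρ 0 = 0) :
    f ((τ ∘ ρ) ∘ Fin.succ) = ((Equiv.Perm.sign ρ : ℤ) : ℝ) * f (τ ∘ Fin.succ) := by
  obtain ⟨⟨p, e⟩, rfl⟩ := Equiv.Perm.decomposeFin.symm.surjective ρ
  obtain rfl : p = 0 := by simpa using hρ
  have h : (τ ∘ Equiv.Perm.decomposeFin.symm (0, e)) ∘ Fin.succ = (τ ∘ Fin.succ) ∘ e := by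
    funext j
    simp
  rw [h, hf]
  simp

theorem IsSkew.altSum {m : ℕ} {f : (Fin m → V) → ℝ} (hf : IsSkew f) :
    IsSkew (altSum f) := by
  intro τ π
  rw [altSum_eq_sum_sign, altSum_eq_sum_sign, Finset.mul_sum,
    ← Equiv.sum_comp π fun i => ((Equiv.Perm.sign π : ℤ) : ℝ) * (_ * _)]
  refine Finset.sum_congr rfl fun i _ => ?_
  set ρ : Equiv.Perm (Fin (m + 1)) := (π i).cycleRange * π * i.cycleRange⁻¹ with hρ
  have h0 : ρ 0 = 0 := by
    have : i.cycleRange⁻¹ 0 = i := by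
      rw [Equiv.Perm.inv_eq_iff_eq, Fin.cycleRange_self]
    simp only [hρ, Equiv.Perm.mul_apply, this, Fin.cycleRange_self]
  have hcomp : (τ ∘ π) ∘ i.cycleRange.symm = (τ ∘ (π i).cycleRange.symm) ∘ ρ := by
    funext j
    simp [hρ]
  rw [hcomp, hf.comp_succ_of_fix_zero _ _ h0]
  have hs : ((Equiv.Perm.sign ρ : ℤ) : ℝ) = ((Equiv.Perm.sign (π i).cycleRange : ℤ) : ℝ) *
      ((Equiv.Perm.sign π : ℤ) : ℝ) * ((Equiv.Perm.sign i.cycleRange : ℤ) : ℝ) := by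
    simp only [hρ, Equiv.Perm.sign_mul, Equiv.Perm.sign_inv, Units.val_mul, Int.cast_mul]
  rw [hs]
  linear_combination ((Equiv.Perm.sign π : ℤ) : ℝ) *
    ((Equiv.Perm.sign (π i).cycleRange : ℤ) : ℝ) *
    f ((τ ∘ (π i).cycleRange.symm) ∘ Fin.succ) * sign_mul_self_cast i.cycleRange

theorem altSum_cons {m : ℕ} (f : (Fin (m + 1) → V) → ℝ) (v : V) (σ : Fin (m + 1) → V) :
    altSum f (Fin.cons v σ) =
      f σ - ∑ i : Fin (m + 1), (-1 : ℝ) ^ (i : ℕ) * f (Fin.cons v (σ ∘ i.succAbove)) := by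
  rw [altSum, Fin.sum_univ_succ, sub_eq_add_neg, ← Finset.sum_neg_distrib]
  congr 1
  · simp
  · refine Finset.sum_congr rfl fun i _ => ?_
    have : (Fin.cons v σ : Fin (m + 2) → V) ∘ i.succ.succAbove =
        Fin.cons v (σ ∘ i.succAbove) := by
      funext j
      refine Fin.cases ?_ (fun k => ?_) j <;> simp
    rw [this, Fin.val_succ, pow_succ]
    ring

variable [Fintype V]

/-- The full Laplacian of the full simplex is multiplication by the number of vertices. -/
theorem consSum_altSum_add_altSum_consSum {m : ℕ} (f : (Fin (m + 1) → V) → ℝ)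
    (σ : Fin (m + 1) → V) :
    consSum (altSum f) σ + altSum (consSum f) σ = Fintype.card V * f σ := by
  have h : altSum (consSum f) σ =
      ∑ v : V, ∑ i : Fin (m + 1), (-1 : ℝ) ^ (i : ℕ) * f (Fin.cons v (σ ∘ i.succAbove)) := by
    simp only [altSum, consSum, Finset.mul_sum]
    exact Finset.sum_comm
  rw [h, consSum, ← Finset.sum_add_distrib]
  simp [altSum_cons]

theorem sum_tuple_succ {m : ℕ} (F : (Fin (m + 1) → V) → ℝ) :
    ∑ τ, F τ = ∑ σ : Fin m → V, ∑ v : V, F (Fin.cons v σ) := by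
  rw [← (Fin.consEquiv fun _ : Fin (m + 1) => V).sum_comp, Fintype.sum_prod_type,
    Finset.sum_comm]
  rfl

theorem IsSkew.sum_mul_altSum {m : ℕ} {g : (Fin (m + 1) → V) → ℝ} (hg : IsSkew g)
    (h : (Fin m → V) → ℝ) :
    ∑ τ, g τ * SComplex.altSum h τ = (m + 1) * ∑ σ, consSum g σ * h σ := by
  have hterm : ∀ i : Fin (m + 1), ∑ τ, g τ * (((Equiv.Perm.sign i.cycleRange : ℤ) : ℝ) *
      h ((τ ∘ i.cycleRange.symm) ∘ Fin.succ)) = ∑ σ, consSum g σ * h σ := by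
    intro i
    rw [← (i.cycleRange.arrowCongr (Equiv.refl V)).symm.sum_comp]
    have : ∀ τ : Fin (m + 1) → V,
        (i.cycleRange.arrowCongr (Equiv.refl V)).symm τ = τ ∘ i.cycleRange := fun τ => rfl
    simp only [this]
    have hc : ∀ τ : Fin (m + 1) → V, (τ ∘ i.cycleRange) ∘ i.cycleRange.symm = τ := fun τ => by
      funext j
      simp
    simp only [hc, hg _ i.cycleRange]
    rw [sum_tuple_succ]
    refine Finset.sum_congr rfl fun σ _ => ?_
    rw [consSum, Finset.sum_mul]
    refine Finset.sum_congr rfl fun v _ => ?_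
    have hcs : (Fin.cons v σ : Fin (m + 1) → V) ∘ Fin.succ = σ := by
      funext j
      simp
    rw [hcs]
    linear_combination g (Fin.cons v σ) * h σ * sign_mul_self_cast i.cycleRange
  simp only [altSum_eq_sum_sign, Finset.mul_sum]
  rw [Finset.sum_comm]
  simp only [hterm]
  simp [← Finset.mul_sum]

theorem IsSkew.card_mul_sum_sq {m : ℕ} {f : (Fin (m + 1) → V) → ℝ} (hf : IsSkew f) :
    (m + 2) * (Fintype.card V * ∑ σ, f σ ^ 2) =
      ∑ τ, SComplex.altSum f τ ^ 2 + (m + 2) * ((m + 1) * ∑ σ, consSum f σ ^ 2) := by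
  have h₁ := hf.altSum.sum_mul_altSum f
  have h₂ := hf.sum_mul_altSum (consSum f)
  have h₃ : Fintype.card V * ∑ σ, f σ ^ 2 =
      ∑ σ, consSum (SComplex.altSum f) σ * f σ + ∑ σ, f σ * SComplex.altSum (consSum f) σ := by
    rw [Finset.mul_sum, ← Finset.sum_add_distrib]
    refine Finset.sum_congr rfl fun σ _ => ?_
    linear_combination -f σ * consSum_altSum_add_altSum_consSum f σ
  push_cast at h₁
  simp only [sq] at h₃ ⊢
  rw [h₃, h₁, h₂]
  ring

variable [DecidableEq V] (X : SComplex V)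

theorem isCell_comp_perm {m : ℕ} (σ : Fin m → V) (π : Equiv.Perm (Fin m)) :
    X.IsCell (σ ∘ π) ↔ X.IsCell σ := by
  have h : tset (σ ∘ π) = tset σ := by
    ext v
    simp only [tset, Finset.mem_image, Finset.mem_univ, true_and, Function.comp_apply]
    exact (π.surjective.exists (p := fun a => σ a = v)).symm
  rw [IsCell, IsCell, h, Equiv.injective_comp]

theorem isCell_cons {m : ℕ} (v : V) (σ : Fin m → V) :
    X.IsCell (Fin.cons v σ : Fin (m + 1) → V) ↔ Function.Injective σ ∧ X.nbr v σ := by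
  have h : tset (Fin.cons v σ : Fin (m + 1) → V) = insert v (tset σ) := by
    ext w
    simp [tset, Fin.exists_fin_succ, eq_comm]
  rw [IsCell, nbr, h, Fin.cons_injective_iff]
  have : v ∉ Set.range σ ↔ v ∉ tset σ := by simp [tset]
  rw [this]
  tauto

theorem IsForm.bdry_eq_consSum {m : ℕ} {f : (Fin (m + 1) → V) → ℝ} (hf : X.IsForm (m + 1) f) :
    X.bdry m f = consSum f := by
  funext σ
  refine Finset.sum_congr rfl fun v _ => ?_
  split_ifs with h
  · rfl
  · exact (hf.2 _ fun hc => h ((X.isCell_cons v σ).1 hc).2).symm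

theorem cobdry_eq_ite {m : ℕ} (f : (Fin m → V) → ℝ) (τ : Fin (m + 1) → V) :
    X.cobdry m f τ = if X.IsCell τ then altSum f τ else 0 := rfl

theorem IsForm.cobdry {m : ℕ} {f : (Fin m → V) → ℝ} (hf : X.IsForm m f) :
    X.IsForm (m + 1) (X.cobdry m f) := by
  refine ⟨fun τ π => ?_, fun τ h => if_neg h⟩
  simp only [cobdry_eq_ite, X.isCell_comp_perm, IsSkew.altSum hf.1 τ π, mul_ite, mul_zero]

theorem IsForm.sum_mul_upLap {m : ℕ} {f : (Fin m → V) → ℝ} (hf : X.IsForm m f) :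
    (m + 1) * ∑ σ, f σ * X.upLap m f σ = ∑ τ, X.cobdry m f τ ^ 2 := by
  have h := IsSkew.sum_mul_altSum (hf.cobdry X).1 f
  rw [upLap, (hf.cobdry X).bdry_eq_consSum]
  simp only [mul_comm (f _)]
  rw [← h]
  refine Finset.sum_congr rfl fun τ _ => ?_
  rw [cobdry_eq_ite]
  split_ifs <;> ring

theorem IsForm.sum_mul_lowLap {m : ℕ} {f : (Fin (m + 1) → V) → ℝ} (hf : X.IsForm (m + 1) f) :
    ∑ σ, f σ * X.lowLap m f σ = (m + 1) * ∑ σ, consSum f σ ^ 2 := by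
  have h := IsSkew.sum_mul_altSum hf.1 (consSum f)
  simp only [sq]
  rw [← h, lowLap, hf.bdry_eq_consSum]
  refine Finset.sum_congr rfl fun σ _ => ?_
  rw [cobdry_eq_ite]
  split_ifs with hc
  · rfl
  · rw [hf.2 σ hc, zero_mul, zero_mul]

end SComplex

open SComplex in
/-- Proposition 3.2(2): for a `(d+1)`-dimensional complex `X` with complete skeleton on
`n` vertices, the spectrum of the full Laplacian `Δ = Δ⁺ + Δ⁻` on `Ω^{d}` lies in `[0, n]`. -/
theorem fullLap_spectrum_bounds (V : Type) [Fintype V] [DecidableEq V] (d : ℕ)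
    (X : SComplex V) (hdim : X.Dim (d + 1)) (hskel : X.CompleteSkeleton (d + 1))
    (μ : ℝ) (f : (Fin (d + 1) → V) → ℝ) (hf : X.IsForm (d + 1) f) (hf0 : f ≠ 0)
    (heig : X.upLap (d + 1) f + X.lowLap d f = μ • f) :
    0 ≤ μ ∧ μ ≤ (Fintype.card V : ℝ) := by
  have hpos : 0 < ∑ σ, f σ ^ 2 := by
    obtain ⟨σ, hσ⟩ := Function.ne_iff.1 hf0
    exact Finset.sum_pos' (fun _ _ => sq_nonneg _) ⟨σ, Finset.mem_univ _, sq_pos_of_ne_zero hσ⟩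
  have hup := hf.sum_mul_upLap X
  have hlow := hf.sum_mul_lowLap X
  have hμ : ∑ σ, f σ * X.upLap (d + 1) f σ + ∑ σ, f σ * X.lowLap d f σ = μ * ∑ σ, f σ ^ 2 := by
    rw [Finset.mul_sum, ← Finset.sum_add_distrib]
    refine Finset.sum_congr rfl fun σ _ => ?_
    have := congrFun heig σ
    simp only [Pi.add_apply, Pi.smul_apply, smul_eq_mul] at this
    linear_combination f σ * this
  have hcard := IsSkew.card_mul_sum_sq hf.1
  have hle : ∑ τ, X.cobdry (d + 1) f τ ^ 2 ≤ ∑ τ, altSum f τ ^ 2 := by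
    refine Finset.sum_le_sum fun τ _ => ?_
    rw [cobdry_eq_ite]
    split_ifs
    · rfl
    · simpa using sq_nonneg (altSum f τ)
  have hup_nonneg : 0 ≤ ∑ τ, X.cobdry (d + 1) f τ ^ 2 := Finset.sum_nonneg fun _ _ => sq_nonneg _
  have hlow_nonneg : 0 ≤ (d + 1 : ℝ) * ∑ σ, consSum f σ ^ 2 := by positivity
  have hd : (0 : ℝ) < d + 2 := by positivity
  have hscaled : (d + 2) * (μ * ∑ σ, f σ ^ 2) = ∑ τ, X.cobdry (d + 1) f τ ^ 2 +
      (d + 2) * ((d + 1) * ∑ σ, consSum f σ ^ 2) := by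
    rw [← hμ, hlow, ← hup]
    push_cast
    ring
  constructor
  · have : 0 ≤ (d + 2) * (μ * ∑ σ, f σ ^ 2) := by rw [hscaled]; positivity
    exact nonneg_of_mul_nonneg_left (nonneg_of_mul_nonneg_right this hd) hpos
  · refine le_of_mul_le_mul_right (le_of_mul_le_mul_left ?_ hd) hpos
    rw [hscaled, hcard]
    gcongr
end
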